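/- arXiv:1604.00576 — 9 statements merged into one kernel-verified Lean document; each statement's English description precedes it below -/
import Mathlib

section
/- Let m be a positive integer, let K be a nonempty compact convex subset of ℝ^m, let x : ℕ → ℝ^m be a sequence with x(T) ∈ K for every T, and let U be a nonempty finite set of vectors in ℝ^m. Then there exists β ∈ K such that min_{u ∈ U} ⟨u, β⟩ = min_{u ∈ U} liminf_{T → ∞} ⟨u, x(T)⟩. -/
open Filter RealInnerProductSpace

/-- A limiting point in a compact convex set realizing the min over a finite set of
cut vectors of the liminf of inner products. -/
theorem stmt_1 (m : ℕ) (hm : 0 < m) (K : Set (EuclideanSpace ℝ (Fin m)))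
    (hKne : K.Nonempty) (hKcomp : IsCompact K) (hKconv : Convex ℝ K)
    (x : ℕ → EuclideanSpace ℝ (Fin m)) (hx : ∀ T, x T ∈ K)
    (U : Finset (EuclideanSpace ℝ (Fin m))) (hU : U.Nonempty) :
    ∃ β ∈ K,
      U.inf' hU (fun u => ⟪u, β⟫) =
        U.inf' hU (fun u => liminf (fun T => ⟪u, x T⟫) atTop) := by
  have hcont (u : EuclideanSpace ℝ (Fin m)) : Continuous fun y => ⟪u, y⟫ := by fun_prop
  have hle (u : EuclideanSpace ℝ (Fin m)) :
      IsBoundedUnder (· ≤ ·) atTop fun T => ⟪u, x T⟫ := by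
    obtain ⟨C, hC⟩ := hKcomp.bddAbove_image (hcont u).continuousOn
    exact isBoundedUnder_of ⟨C, fun T => hC (Set.mem_image_of_mem _ (hx T))⟩
  have hge (u : EuclideanSpace ℝ (Fin m)) :
      IsBoundedUnder (· ≥ ·) atTop fun T => ⟪u, x T⟫ := by
    obtain ⟨C, hC⟩ := hKcomp.bddBelow_image (hcont u).continuousOn
    exact isBoundedUnder_of ⟨C, fun T => hC (Set.mem_image_of_mem _ (hx T))⟩
  obtain ⟨v, hvU, hv⟩ :=
    U.exists_mem_eq_inf' hU fun u => liminf (fun T => ⟪u, x T⟫) atTop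
  obtain ⟨φ, hφ, hφv⟩ :=
    (MapClusterPt.liminf (hle v).isCoboundedUnder_ge (hge v)).tendsto_subseq
  obtain ⟨β, hβK, ψ, hψ, hψβ⟩ := hKcomp.tendsto_subseq fun n => hx (φ n)
  have hlim (u : EuclideanSpace ℝ (Fin m)) :
      Tendsto (fun n => ⟪u, x (φ (ψ n))⟫) atTop (nhds ⟪u, β⟫) :=
    ((hcont u).tendsto β).comp hψβ
  have hvβ : ⟪v, β⟫ = liminf (fun T => ⟪v, x T⟫) atTop :=
    tendsto_nhds_unique (hlim v) (hφv.comp hψ.tendsto_atTop)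
  refine ⟨β, hβK, le_antisymm ?_ (Finset.le_inf' hU _ fun u hu => ?_)⟩
  · rw [hv, ← hvβ]
    exact Finset.inf'_le _ hvU
  · exact (Finset.inf'_le _ hu).trans
      (((hlim u).mapClusterPt.of_comp (φ := φ ∘ ψ) (u := fun T => ⟪u, x T⟫)
        (hφ.comp hψ).tendsto_atTop).liminf_le (hge u))
end

section
/- Let m be a positive integer, Ξ a nonempty finite index set, and for each σ ∈ Ξ let K_σ be a nonempty compact convex subset of ℝ^m and ζ_σ : ℕ → ℝ^m a sequence with ζ_σ(T) ∈ K_σ for every T. Let p : Ξ → ℝ satisfy p(σ) ≥ 0 for all σ, and let U be a nonempty finite set of vectors in ℝ^m. Then there exists a family (β_σ)_{σ∈Ξ} with β_σ ∈ K_σ for every σ, such that min_{u ∈ U} ⟨u, Σ_{σ∈Ξ} p(σ)·β_σ⟩ = min_{u ∈ U} Σ_{σ∈Ξ} p(σ)·liminf_{T → ∞} ⟨u, ζ_σ(T)⟩. -/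
open Filter RealInnerProductSpace

/-- A sequence in a compact set has a cluster point, at which every linear functional is at
least its limit inferior along the sequence. -/
theorem IsCompact.exists_forall_liminf_inner_le {E : Type*} [NormedAddCommGroup E]
    [InnerProductSpace ℝ E] {K : Set E} (hK : IsCompact K) {ζ : ℕ → E} (hζ : ∀ T, ζ T ∈ K) :
    ∃ x ∈ K, ∀ u : E, liminf (fun T => ⟪u, ζ T⟫) atTop ≤ ⟪u, x⟫ := by
  obtain ⟨x, hx, φ, hφ, hlim⟩ := hK.tendsto_subseq hζ
  refine ⟨x, hx, fun u => ?_⟩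
  have hu : Tendsto (fun n => ⟪u, ζ (φ n)⟫) atTop (nhds ⟪u, x⟫) := tendsto_const_nhds.inner hlim
  obtain ⟨c, hc⟩ := (hK.image (f := fun y => ⟪u, y⟫) (by fun_prop)).bddBelow
  have hbdd : IsBoundedUnder (· ≥ ·) atTop fun T => ⟪u, ζ T⟫ :=
    isBoundedUnder_of ⟨c, fun T => hc ⟨ζ T, hζ T, rfl⟩⟩
  refine le_of_forall_lt fun a ha => ?_
  obtain ⟨b, hab, hb⟩ := exists_between ha
  have hev := eventually_lt_of_lt_liminf hb hbdd
  exact hab.trans_le (ge_of_tendsto hu ((hφ.tendsto_atTop.eventually hev).mono fun _ h => h.le))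

/-- A linear functional has a minimiser on a compact set, and its value there is at most its limit
inferior along any sequence in the set. -/
theorem IsCompact.exists_inner_le_liminf {E : Type*} [NormedAddCommGroup E]
    [InnerProductSpace ℝ E] {K : Set E} (hK : IsCompact K) {ζ : ℕ → E} (hζ : ∀ T, ζ T ∈ K)
    (u : E) : ∃ x ∈ K, ⟪u, x⟫ ≤ liminf (fun T => ⟪u, ζ T⟫) atTop := by
  have hcont : ContinuousOn (fun y => ⟪u, y⟫) K := by fun_prop
  obtain ⟨x, hx, hmin⟩ := hK.exists_isMinOn ⟨ζ 0, hζ 0⟩ hcont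
  obtain ⟨c, hc⟩ := (hK.image_of_continuousOn hcont).bddAbove
  have hbdd : IsBoundedUnder (· ≤ ·) atTop fun T => ⟪u, ζ T⟫ :=
    isBoundedUnder_of ⟨c, fun T => hc ⟨ζ T, hζ T, rfl⟩⟩
  exact ⟨x, hx, le_liminf_of_le hbdd.isCoboundedUnder_ge (.of_forall fun T => hmin (hζ T))⟩

/-- Deterministic core of Lemma 1: time-averaged activations per configuration can be
replaced by fixed points of the compact convex activation sets. -/
theorem stmt_2 (m : ℕ) (hm : 0 < m) (Ξ : Type) [Fintype Ξ] [Nonempty Ξ]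
    (K : Ξ → Set (EuclideanSpace ℝ (Fin m)))
    (hKne : ∀ σ, (K σ).Nonempty) (hKcomp : ∀ σ, IsCompact (K σ))
    (hKconv : ∀ σ, Convex ℝ (K σ))
    (ζ : Ξ → ℕ → EuclideanSpace ℝ (Fin m)) (hζ : ∀ σ T, ζ σ T ∈ K σ)
    (p : Ξ → ℝ) (hp : ∀ σ, 0 ≤ p σ)
    (U : Finset (EuclideanSpace ℝ (Fin m))) (hU : U.Nonempty) :
    ∃ β : Ξ → EuclideanSpace ℝ (Fin m), (∀ σ, β σ ∈ K σ) ∧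
      U.inf' hU (fun u => ⟪u, ∑ σ, p σ • β σ⟫) =
        U.inf' hU (fun u => ∑ σ, p σ * liminf (fun T => ⟪u, ζ σ T⟫) atTop) := by
  choose b hbK hb using fun σ => (hKcomp σ).exists_forall_liminf_inner_le (hζ σ)
  obtain ⟨v, hvU, hv⟩ := U.exists_mem_eq_inf' hU
    fun u => ∑ σ, p σ * liminf (fun T => ⟪u, ζ σ T⟫) atTop
  choose a haK ha using fun σ => (hKcomp σ).exists_inner_le_liminf (hζ σ) v
  have hinner (u : EuclideanSpace ℝ (Fin m)) (β : Ξ → EuclideanSpace ℝ (Fin m)) :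
      ⟪u, ∑ σ, p σ • β σ⟫ = ∑ σ, p σ * ⟪u, β σ⟫ := by
    simp only [inner_sum, inner_smul_right]
  have hcont : Continuous fun β : Ξ → EuclideanSpace ℝ (Fin m) =>
      U.inf' hU fun u => ⟪u, ∑ σ, p σ • β σ⟫ :=
    Continuous.finset_inf'_apply hU fun u _ => by fun_prop
  have hconn : IsPreconnected (Set.univ.pi K) := (convex_pi fun σ _ => hKconv σ).isPreconnected
  have hlow : U.inf' hU (fun u => ⟪u, ∑ σ, p σ • a σ⟫) ≤
      U.inf' hU (fun u => ∑ σ, p σ * liminf (fun T => ⟪u, ζ σ T⟫) atTop) := by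
    rw [hv]
    refine (U.inf'_le _ hvU).trans ?_
    rw [hinner]
    exact Finset.sum_le_sum fun σ _ => mul_le_mul_of_nonneg_left (ha σ) (hp σ)
  have hupp : U.inf' hU (fun u => ∑ σ, p σ * liminf (fun T => ⟪u, ζ σ T⟫) atTop) ≤
      U.inf' hU (fun u => ⟪u, ∑ σ, p σ • b σ⟫) := by
    refine Finset.le_inf' _ _ fun u hu => (U.inf'_le _ hu).trans ?_
    rw [hinner]
    exact Finset.sum_le_sum fun σ _ => mul_le_mul_of_nonneg_left (hb σ u) (hp σ)
  obtain ⟨β, hβ, hβV⟩ := hconn.intermediate_value (fun σ _ => haK σ) (fun σ _ => hbK σ)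
    hcont.continuousOn ⟨hlow, hupp⟩
  exact ⟨β, fun σ => hβ σ trivial, hβV⟩
end

section
/- Let V be a finite type with at least two elements, r ∈ V, f : V → ℕ, and x : V → V → ℝ a weight function satisfying x(i, j) ≥ 0 for all i, j and x(i, j) = 0 whenever ¬(f(i) < f(j)). For a subset U ⊆ V define cut(U) = Σ_{i ∈ U} Σ_{j ∉ U} x(i, j). Then the minimum of cut(U) over all subsets U ⊆ V with r ∈ U and U ≠ V equals the minimum over all j ∈ V with j ≠ r of Σ_{i ∈ V} x(i, j). -/
/-- The cut that isolates a node `j` without a loop weighs as much as all arcs into `j`. -/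
theorem cut_compl_singleton {V R : Type*} [Fintype V] [DecidableEq V] [AddCommMonoid R]
    (x : V → V → R) {j : V} (hj : x j j = 0) :
    ∑ i ∈ ({j} : Finset V)ᶜ, ∑ k ∈ (({j} : Finset V)ᶜ)ᶜ, x i k = ∑ i, x i j := by
  simp only [compl_compl, Finset.sum_singleton]
  refine Finset.sum_subset (Finset.subset_univ _) fun i _ hi => ?_
  obtain rfl : i = j := by simpa using hi
  exact hj

/-- In a weighted digraph topologically ordered by `f`, every proper cut weighs at least as much
as all arcs into some node outside it. -/
theorem exists_sum_into_le_cut {V : Type*} [Fintype V] [DecidableEq V] {f : V → ℕ}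
    {x : V → V → ℝ} (hx : ∀ i j, 0 ≤ x i j) (hdag : ∀ i j, ¬ f i < f j → x i j = 0)
    {U : Finset V} (hU : U ≠ Finset.univ) :
    ∃ j ∉ U, ∑ i, x i j ≤ ∑ i ∈ U, ∑ k ∈ Uᶜ, x i k := by
  have hne : Uᶜ.Nonempty := by
    rwa [Finset.nonempty_iff_ne_empty, Ne, Finset.compl_eq_empty_iff]
  obtain ⟨j, hj, hmin⟩ := Finset.exists_min_image Uᶜ f hne
  refine ⟨j, Finset.mem_compl.mp hj, ?_⟩
  calc ∑ i, x i j = ∑ i ∈ U, x i j :=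
        (Finset.sum_subset (Finset.subset_univ U) fun i _ hi =>
          hdag i j (hmin i (Finset.mem_compl.mpr hi)).not_gt).symm
    _ ≤ ∑ i ∈ U, ∑ k ∈ Uᶜ, x i k :=
        Finset.sum_le_sum fun i _ =>
          Finset.single_le_sum (f := fun k => x i k) (fun k _ => hx i k) hj

/-- In a weighted DAG with source `r`, the minimum cut value over all proper cuts
equals the minimum over single-node cuts. -/
theorem stmt_5 (V : Type) [Fintype V] [DecidableEq V]
    (hV : 1 < Fintype.card V) (r : V) (f : V → ℕ) (x : V → V → ℝ)
    (hx : ∀ i j, 0 ≤ x i j) (hdag : ∀ i j, ¬ f i < f j → x i j = 0) :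
    sInf {c : ℝ | ∃ U : Finset V, r ∈ U ∧ U ≠ Finset.univ ∧
        c = ∑ i ∈ U, ∑ j ∈ Uᶜ, x i j} =
      sInf {c : ℝ | ∃ j : V, j ≠ r ∧ c = ∑ i : V, x i j} := by
  obtain ⟨j₀, hj₀⟩ := Fintype.exists_ne_of_one_lt_card hV r
  have isolate : ∀ j, j ≠ r → ∃ U : Finset V, r ∈ U ∧ U ≠ Finset.univ ∧
      ∑ i, x i j = ∑ i ∈ U, ∑ k ∈ Uᶜ, x i k := fun j hj =>
    ⟨{j}ᶜ, by simpa using hj.symm, by simp,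
      (cut_compl_singleton x (hdag j j (lt_irrefl _))).symm⟩
  apply le_antisymm
  · refine le_csInf ⟨_, j₀, hj₀, rfl⟩ ?_
    rintro _ ⟨j, hj, rfl⟩
    refine csInf_le ⟨0, ?_⟩ (isolate j hj)
    rintro _ ⟨U, -, -, rfl⟩
    exact Finset.sum_nonneg fun i _ => Finset.sum_nonneg fun k _ => hx i k
  · refine le_csInf ⟨_, isolate j₀ hj₀⟩ ?_
    rintro _ ⟨U, hr, hU, rfl⟩
    obtain ⟨j, hj, hle⟩ := exists_sum_into_le_cut hx hdag hU
    refine le_trans (csInf_le ⟨0, ?_⟩ ⟨j, fun h => hj (h ▸ hr), rfl⟩) hle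
    rintro _ ⟨k, -, rfl⟩
    exact Finset.sum_nonneg fun i _ => hx i k
end

section
/- Let V be a finite type, r ∈ V, and N : V → Finset(V) with N(j) nonempty for every j ≠ r. Let R, R' : V → ℝ and a : V → ℝ with a(i) ≥ 0 for all i, satisfying: (i) R(i) ≤ R'(i) ≤ R(i) + a(i) for every i ∈ V; and (ii) for every j ≠ r, R'(j) ≥ min( R(j) + a(j), min_{i ∈ N(j)} R(i) ). Fix j ≠ r and let i* ∈ N(j) be any element attaining min_{i ∈ N(j)} (R(i) − R(j)). Then min_{i ∈ N(j)} (R'(i) − R'(j)) ≤ max( min_{i ∈ N(j)} (R(i) − R(j)) − a(j), 0 ) + a(i*). -/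
/-- Deterministic form of Lemma 3: the virtual queues `X_j` satisfy a Lindley
recursion under any in-order broadcast policy. -/
theorem stmt_6 (V : Type) [Fintype V] (r : V) (N : V → Finset V)
    (hN : ∀ j, j ≠ r → (N j).Nonempty)
    (R R' a : V → ℝ) (ha : ∀ i, 0 ≤ a i)
    (h1 : ∀ i, R i ≤ R' i ∧ R' i ≤ R i + a i)
    (h2 : ∀ j, ∀ hj : j ≠ r, min (R j + a j) ((N j).inf' (hN j hj) R) ≤ R' j)
    (j : V) (hj : j ≠ r) (istar : V) (histar : istar ∈ N j)
    (hmin : (N j).inf' (hN j hj) (fun i => R i - R j) = R istar - R j) :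
    (N j).inf' (hN j hj) (fun i => R' i - R' j) ≤
      max ((N j).inf' (hN j hj) (fun i => R i - R j) - a j) 0 + a istar := by
  have h_le : R istar ≤ (N j).inf' (hN j hj) R := by
    refine Finset.le_inf' _ _ fun i hi => ?_
    have := Finset.inf'_le (fun i => R i - R j) hi
    linarith
  have h_inf := Finset.inf'_le (fun i => R' i - R' j) histar
  have h_star := (h1 istar).2
  rw [hmin]
  rcases min_le_iff.mp (h2 j hj) with h | h
  · linarith [le_max_left (R istar - R j - a j) 0]
  · linarith [le_max_right (R istar - R j - a j) 0]
end

section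
/- Let V be a finite type, E : V → V → Prop a decidable relation, and f : V → ℕ with f(i) < f(j) whenever E(i, j). Let r ∈ V be such that no i satisfies E(i, r), and such that for every j ≠ r there exists i with E(i, j). Let R : V → ℝ, and for each j ≠ r set X_j = min over { i : E(i, j) } of (R(i) − R(j)); assume X_j ≥ 0 for every j ≠ r. Then for every j ∈ V: R(r) − Σ_{j' ≠ r} X_{j'} ≤ R(j) ≤ R(r). -/
/-- Core of Lemma 4: in a DAG with unique source `r`, the packet count of every node
is sandwiched between `R r` minus the total virtual-queue backlog and `R r`. -/
theorem stmt_7 (V : Type) [Fintype V] [DecidableEq V]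
    (E : V → V → Prop) [DecidableRel E] (f : V → ℕ)
    (hf : ∀ i j, E i j → f i < f j) (r : V)
    (hr : ¬ ∃ i, E i r) (hin : ∀ j, j ≠ r → ∃ i, E i j)
    (R : V → ℝ) (X : V → ℝ)
    (hX : ∀ j, j ≠ r → IsLeast {y : ℝ | ∃ i, E i j ∧ y = R i - R j} (X j))
    (hXnn : ∀ j, j ≠ r → 0 ≤ X j) :
    ∀ j : V, R r - ∑ j' ∈ Finset.univ.filter (fun j' => j' ≠ r), X j' ≤ R j ∧
      R j ≤ R r := by
  -- Strong induction along `f`, summing only over the nodes up to the level of `j`.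
  have level_bound : ∀ n j, f j = n →
      R r - ∑ j' ∈ Finset.univ.filter (fun j' => j' ≠ r ∧ f j' ≤ n), X j' ≤ R j ∧
        R j ≤ R r := by
    intro n
    induction n using Nat.strong_induction_on with
    | _ n ih =>
      rintro j rfl
      by_cases hj : j = r
      · subst hj
        refine ⟨sub_le_self _ (Finset.sum_nonneg fun k hk => ?_), le_rfl⟩
        exact hXnn k (Finset.mem_filter.mp hk).2.1
      · obtain ⟨i, hij, hXi⟩ := (hX j hj).1
        have hlt := hf i j hij
        obtain ⟨hlow, hupp⟩ := ih (f i) hlt i rfl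
        have hnn := hXnn j hj
        have hnot : j ∉ Finset.univ.filter (fun j' => j' ≠ r ∧ f j' ≤ f i) := by
          simp [hlt]
        have hsum := Finset.sum_le_sum_of_subset_of_nonneg (f := X)
          (s := insert j (Finset.univ.filter (fun j' => j' ≠ r ∧ f j' ≤ f i)))
          (t := Finset.univ.filter (fun j' => j' ≠ r ∧ f j' ≤ f j))
          (by
            intro k hk
            simp only [Finset.mem_insert, Finset.mem_filter, Finset.mem_univ, true_and] at hk ⊢
            rcases hk with rfl | ⟨hk, hle⟩
            · exact ⟨hj, le_rfl⟩
            · exact ⟨hk, hle.trans hlt.le⟩)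
          (fun k hk _ => hXnn k (Finset.mem_filter.mp hk).2.1)
        rw [Finset.sum_insert hnot] at hsum
        constructor <;> linarith
  intro j
  obtain ⟨hlow, hupp⟩ := level_bound (f j) j rfl
  refine ⟨le_trans (sub_le_sub_left ?_ _) hlow, hupp⟩
  refine Finset.sum_le_sum_of_subset_of_nonneg ?_
    fun k hk _ => hXnn k (Finset.mem_filter.mp hk).2
  exact Finset.monotone_filter_right _ fun k _ hk => hk.1
end

section
/- Let V be a finite type, r ∈ V, and N : V → Finset(V) with N(j) nonempty for every j ≠ r. Let R, R' : V → ℝ and a : V → ℝ with a(i) ≥ 0 for all i, satisfying: (i) R(i) ≤ R'(i) ≤ R(i) + a(i) for every i ∈ V; and (ii) for every j ≠ r, R'(j) ≥ min( R(j) + a(j), min_{i ∈ N(j)} R(i) ). Fix j ≠ r, let i* ∈ N(j) attain min_{i ∈ N(j)} (R(i) − R(j)), and set X = min_{i ∈ N(j)} (R(i) − R(j)) and X' = min_{i ∈ N(j)} (R'(i) − R'(j)). If moreover X ≥ 0 and X' ≥ 0, then X'² − X² ≤ a(j)² + a(i*)² + 2·X·(a(i*) − a(j)). -/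
/-- Per-queue quadratic drift inequality (Eq. (25)): combining the Lindley recursion for
the virtual queues with the quadratic drift bound. -/
theorem stmt_8 (V : Type) [Fintype V] (r : V) (N : V → Finset V)
    (hN : ∀ j, j ≠ r → (N j).Nonempty)
    (R R' a : V → ℝ) (ha : ∀ i, 0 ≤ a i)
    (h1 : ∀ i, R i ≤ R' i ∧ R' i ≤ R i + a i)
    (h2 : ∀ j, ∀ hj : j ≠ r, min (R j + a j) ((N j).inf' (hN j hj) R) ≤ R' j)
    (j : V) (hj : j ≠ r) (istar : V) (histar : istar ∈ N j)
    (hmin : (N j).inf' (hN j hj) (fun i => R i - R j) = R istar - R j)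
    (X X' : ℝ)
    (hXdef : X = (N j).inf' (hN j hj) (fun i => R i - R j))
    (hX'def : X' = (N j).inf' (hN j hj) (fun i => R' i - R' j))
    (hX : 0 ≤ X) (hX' : 0 ≤ X') :
    X' ^ 2 - X ^ 2 ≤ a j ^ 2 + a istar ^ 2 + 2 * X * (a istar - a j) := by
  have hR : R istar ≤ (N j).inf' (hN j hj) R := by
    refine Finset.le_inf' _ _ fun i hi => ?_
    have := Finset.inf'_le (fun i => R i - R j) hi
    linarith
  have hX'le : X' ≤ R' istar - R' j := hX'def ▸ Finset.inf'_le (fun i => R' i - R' j) histar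
  have hXeq : X = R istar - R j := hXdef.trans hmin
  have hstar := (h1 istar).2
  have haj := ha j
  have has := ha istar
  rcases min_le_iff.mp (h2 j hj) with h | h
  · have hle : X' ≤ X - a j + a istar := by linarith
    nlinarith [pow_le_pow_left₀ hX' hle 2, mul_nonneg haj has]
  · have hle : X' ≤ a istar := by linarith
    nlinarith [pow_le_pow_left₀ hX' hle 2, mul_nonneg hX has, sq_nonneg (X - a j)]
end

section
/- Let L : ℕ → ℝ and f : ℕ → ℝ with L(t) ≥ 0 and f(t) ≥ 0 for all t, let B ∈ ℝ and c > 0, and suppose L(t+1) − L(t) ≤ B − c·f(t) for every t ∈ ℕ. Then limsup_{T → ∞} (1/T)·Σ_{t=0}^{T−1} f(t) ≤ B/c. -/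
open Filter

/-- Summing the drift inequality bounds the partial sums of `f`. -/
theorem mul_sum_range_le_of_drift (L f : ℕ → ℝ) (hL : ∀ t, 0 ≤ L t) (B c : ℝ)
    (hdrift : ∀ t : ℕ, L (t + 1) - L t ≤ B - c * f t) (T : ℕ) :
    c * ∑ t ∈ Finset.range T, f t ≤ T * B + L 0 := by
  have h := Finset.sum_le_sum fun t (_ : t ∈ Finset.range T) => hdrift t
  rw [Finset.sum_range_sub, Finset.sum_sub_distrib, ← Finset.mul_sum, Finset.sum_const,
    Finset.card_range, nsmul_eq_mul] at h
  linarith [hL T]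

/-- Telescoping drift argument (proof of Lemma 5): negative Lyapunov drift implies the
Cesàro averages of `f` are bounded in the limsup by `B / c`. -/
theorem stmt_9 (L f : ℕ → ℝ) (hL : ∀ t, 0 ≤ L t) (hf : ∀ t, 0 ≤ f t)
    (B c : ℝ) (hc : 0 < c)
    (hdrift : ∀ t : ℕ, L (t + 1) - L t ≤ B - c * f t) :
    limsup (fun T : ℕ => (1 / (T : ℝ)) * ∑ t ∈ Finset.range T, f t) atTop ≤ B / c := by
  have hlim : Tendsto (fun T : ℕ => B / c + L 0 / c / (T : ℝ)) atTop (nhds (B / c)) := by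
    simpa using tendsto_const_nhds.add (tendsto_const_div_atTop_nhds_zero_nat (L 0 / c))
  rw [← hlim.limsup_eq]
  refine limsup_le_limsup ?_ ?_ hlim.isBoundedUnder_le
  · filter_upwards [eventually_gt_atTop 0] with T hT
    have hT' : (0 : ℝ) < T := Nat.cast_pos.mpr hT
    have h := mul_sum_range_le_of_drift L f hL B c hdrift T
    have e : B / c + L 0 / c / (T : ℝ) = 1 / (T : ℝ) * ((T * B + L 0) / c) := by
      field_simp
    rw [e]
    gcongr
    rw [le_div_iff₀ hc]
    linarith
  · exact isCoboundedUnder_le_of_le atTop (x := 0) fun T =>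
      mul_nonneg (by positivity) (Finset.sum_nonneg fun t _ => hf t)
end

section
/- Consider the directed 3×3 grid with vertex set {r, a, b, c, d, e, f, g, h} (rows r a b / c d e / f g h) and the 12 directed edges r→a, a→b, c→d, d→e, f→g, g→h, r→c, a→d, b→e, c→f, d→g, e→h, each of unit capacity. A matching is a set of these edges no two of which share an endpoint; identify each matching with its indicator vector in ℝ^{12}, and for β ∈ ℝ^{12} define the inflow of a vertex v as the sum of the coordinates of β over the edges ending at v. Then for every β in the convex hull (over ℝ) of the indicator vectors of all matchings, the minimum over v ∈ {a, b, c, d, e, f, g, h} of the inflow of v is at most 2/5. -/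
/-- The 12 directed edges of the 3×3 grid on vertices
`r=0, a=1, b=2, c=3, d=4, e=5, f=6, g=7, h=8` (rows r a b / c d e / f g h). -/
def gridEdges : Fin 12 → Fin 9 × Fin 9 :=
  ![(0, 1), (1, 2), (3, 4), (4, 5), (6, 7), (7, 8),
    (0, 3), (1, 4), (2, 5), (3, 6), (4, 7), (5, 8)]

/-- A set of edges is a matching if no two distinct edges share an endpoint. -/
def IsGridMatching (s : Finset (Fin 12)) : Prop :=
  ∀ e₁ ∈ s, ∀ e₂ ∈ s, e₁ ≠ e₂ →
    (gridEdges e₁).1 ≠ (gridEdges e₂).1 ∧ (gridEdges e₁).1 ≠ (gridEdges e₂).2 ∧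
    (gridEdges e₁).2 ≠ (gridEdges e₂).1 ∧ (gridEdges e₁).2 ≠ (gridEdges e₂).2

/-- The indicator vector in ℝ^12 of a set of edges. -/
def matchingIndicator (s : Finset (Fin 12)) : Fin 12 → ℝ :=
  fun i => if i ∈ s then 1 else 0

/-- Total inflow of vertex `v` under the fractional activation `β`. -/
def gridInflow (β : Fin 12 → ℝ) (v : Fin 9) : ℝ :=
  ∑ i : Fin 12, if (gridEdges i).2 = v then β i else 0

/-- Pairwise adjacent edges carry total activation at most one, throughout the convex hull of
the matching indicators. -/
lemma sum_le_one_of_mem_convexHull_matchings {β : Fin 12 → ℝ} (T : Finset (Fin 12))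
    (hT : ∀ s, IsGridMatching s → (T ∩ s).card ≤ 1)
    (hβ : β ∈ convexHull ℝ
      {x : Fin 12 → ℝ | ∃ s : Finset (Fin 12), IsGridMatching s ∧ x = matchingIndicator s}) :
    ∑ i ∈ T, β i ≤ 1 := by
  have hlin : IsLinearMap ℝ fun x : Fin 12 → ℝ => ∑ i ∈ T, x i :=
    ⟨fun x y => by simp [Finset.sum_add_distrib], fun c x => by simp [Finset.mul_sum]⟩
  refine convexHull_min ?_ (convex_halfSpace_le hlin 1) hβ
  rintro _ ⟨s, hs, rfl⟩
  have := hT s hs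
  simpa [matchingIndicator, Finset.sum_ite_mem] using this

/-- A matching contains at most one of the edges incident to a given vertex. -/
lemma IsGridMatching.card_inter_incident_le_one {s : Finset (Fin 12)} (hs : IsGridMatching s)
    (v : Fin 9) :
    ((Finset.univ.filter fun i => (gridEdges i).1 = v ∨ (gridEdges i).2 = v) ∩ s).card ≤ 1 := by
  rw [Finset.card_le_one]
  intro i hi j hj
  simp only [Finset.mem_inter, Finset.mem_filter, Finset.mem_univ, true_and] at hi hj
  by_contra hij
  have := hs i hi.2 j hj.2 hij
  grind

/-- Converse part of Proposition 1: for any fractional activation in the convex hull of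
matchings of the 3×3 grid, some non-source vertex receives inflow at most 2/5. -/
theorem stmt_14 (β : Fin 12 → ℝ)
    (hβ : β ∈ convexHull ℝ
      {x : Fin 12 → ℝ | ∃ s : Finset (Fin 12), IsGridMatching s ∧ x = matchingIndicator s}) :
    (Finset.univ.filter (fun v : Fin 9 => v ≠ 0)).inf'
      (by decide) (fun v => gridInflow β v) ≤ 2 / 5 := by
  by_contra! h
  rw [Finset.lt_inf'_iff] at h
  have inflow (v : Fin 9) (hv : v ≠ 0) : 2 / 5 < gridInflow β v := h v (by simp [hv])
  have degree (v : Fin 9) :=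
    sum_le_one_of_mem_convexHull_matchings _
      (fun _ hs => hs.card_inter_incident_le_one v) hβ
  have a_in := inflow 1 (by decide)
  have b_in := inflow 2 (by decide)
  have c_in := inflow 3 (by decide)
  have d_in := inflow 4 (by decide)
  have f_in := inflow 6 (by decide)
  have a_deg := degree 1
  have c_deg := degree 3
  simp [gridInflow, gridEdges, Fin.sum_univ_succ] at a_in b_in c_in d_in f_in
  rw [Finset.sum_filter] at a_deg c_deg
  simp [gridEdges, Fin.sum_univ_succ] at a_deg c_deg
  linarith
end

section
/- Consider the directed 3×3 grid with vertex set {r, a, b, c, d, e, f, g, h} (rows r a b / c d e / f g h) and the 12 directed edges r→a, a→b, c→d, d→e, f→g, g→h, r→c, a→d, b→e, c→f, d→g, e→h, each of unit capacity. A matching is a set of these edges no two of which share an endpoint; identify each matching with its indicator vector in ℝ^{12}, and for β ∈ ℝ^{12} define the inflow of a vertex v as the sum of the coordinates of β over the edges ending at v. Then there exists β in the convex hull (over ℝ) of the indicator vectors of all matchings such that the inflow of v is at least 2/5 for every v ∈ {a, b, c, d, e, f, g, h}. -/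
instance (s : Finset (Fin 12)) : Decidable (IsGridMatching s) := by
  unfold IsGridMatching
  infer_instance

/-- Five matchings of the grid which together enter every non-source vertex twice. -/
def coveringMatchings : Fin 5 → Finset (Fin 12) :=
  ![{0, 2, 4}, {0, 3, 9}, {1, 3, 6}, {1, 5, 9}, {4, 6, 7, 11}]

theorem isGridMatching_coveringMatchings : ∀ k, IsGridMatching (coveringMatchings k) := by
  decide

theorem card_coveringMatchings_entering :
    ∀ v : Fin 9, v ≠ 0 →
      2 ≤ ∑ k, ∑ i, if (gridEdges i).2 = v ∧ i ∈ coveringMatchings k then 1 else 0 := by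
  decide

theorem gridInflow_sum_smul {ι : Type*} [Fintype ι] (w : ι → ℝ) (x : ι → Fin 12 → ℝ)
    (v : Fin 9) : gridInflow (∑ k, w k • x k) v = ∑ k, w k * gridInflow (x k) v := by
  simp only [gridInflow, Finset.mul_sum, Finset.sum_apply, Pi.smul_apply, smul_eq_mul]
  rw [Finset.sum_comm]
  refine Finset.sum_congr rfl fun i _ => ?_
  split_ifs <;> simp

theorem gridInflow_matchingIndicator (s : Finset (Fin 12)) (v : Fin 9) :
    gridInflow (matchingIndicator s) v =
      ((∑ i, if (gridEdges i).2 = v ∧ i ∈ s then 1 else 0 : ℕ) : ℝ) := by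
  simp only [gridInflow, matchingIndicator, ite_and, Nat.cast_sum, Nat.cast_ite, Nat.cast_one,
    Nat.cast_zero]

/-- Achievability part of Proposition 1: some fractional activation in the convex hull
of matchings of the 3×3 grid gives every non-source vertex inflow at least 2/5. -/
theorem stmt_15 :
    ∃ β ∈ convexHull ℝ
      {x : Fin 12 → ℝ | ∃ s : Finset (Fin 12), IsGridMatching s ∧ x = matchingIndicator s},
      ∀ v : Fin 9, v ≠ 0 → 2 / 5 ≤ gridInflow β v := by
  refine ⟨∑ k, (1 / 5 : ℝ) • matchingIndicator (coveringMatchings k), ?_, fun v hv => ?_⟩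
  · refine (convex_convexHull ℝ _).sum_mem (fun _ _ => by norm_num) (by norm_num) fun k _ => ?_
    exact subset_convexHull ℝ _ ⟨_, isGridMatching_coveringMatchings k, rfl⟩
  · have h : (2 : ℝ) ≤ _ := Nat.cast_le.mpr (card_coveringMatchings_entering v hv)
    rw [gridInflow_sum_smul, ← Finset.mul_sum]
    simp only [gridInflow_matchingIndicator]
    rw [← Nat.cast_sum]
    linarith
end
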